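/- arXiv:1705.10925 — 5 statements merged into one kernel-verified Lean document; each statement's English description precedes it below -/
import Mathlib

section
/- Let P be a transition matrix associated with G, let P̄ be its lift to the spanning tree graph Ḡ, and let m' be the integer-valued function on strongly connected subsets of V defined by the recursion m'(V) = 1 and m'(W) = k(W) − ∑_{W' strongly connected, W ⊊ W' ⊆ V} m'(W') for strongly connected W ⊊ V. Then for every s ∈ ℝ, det(1 − s•P̄) · ∏_W det((1 − s•P)|_W)^{(−m'(W))₊} = det(1 − s•P) · ∏_W det((1 − s•P)|_W)^{(m'(W))₊}, where both products range over all strongly connected proper subsets W ⊊ V. (Equivalently, the ratio R(s) = det(1 − s•P̄)/det(1 − s•P) equals ∏_W det((1 − s•P)|_W)^{m'(W)}.) -/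
open Matrix Finset Classical

noncomputable section

/-- A directed rooted spanning tree of the graph with edge set `E`, rooted at `r`,
encoded as the "parent" function `t`. -/
def IsSpanningTree {V : Type*} (E : Set (V × V)) (r : V) (t : V → V) : Prop :=
  t r = r ∧ (∀ v, v ≠ r → (v, t v) ∈ E) ∧ ∀ v, ∃ n, t^[n] v = r

/-- The set `V̄` of all spanning trees of the graph, over all roots, as a type:
a pair of the parent function and the root. -/
abbrev STree {V : Type*} (E : Set (V × V)) : Type _ :=
  {p : (V → V) × V // IsSpanningTree E p.2 p.1}

def STree.tree {V : Type*} {E : Set (V × V)} (t : STree E) : V → V := t.1.1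

def STree.root {V : Type*} {E : Set (V × V)} (t : STree E) : V := t.1.2

noncomputable instance STree.instFintype {V : Type*} [Finite V] {E : Set (V × V)} :
    Fintype (STree E) := Fintype.ofFinite _

/-- The edge relation of the spanning tree graph `Ḡ`. -/
def STreeEdge {V : Type*} [DecidableEq V] (E : Set (V × V)) (t t' : STree E) : Prop :=
  t.root ≠ t'.root ∧ (t.root, t'.root) ∈ E ∧
    t'.tree = Function.update (Function.update t.tree t.root t'.root) t'.root t'.root

/-- The edge set of the spanning tree graph `Ḡ`. -/
def liftEdges {V : Type*} [DecidableEq V] (E : Set (V × V)) : Set (STree E × STree E) :=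
  {p | STreeEdge E p.1 p.2}

/-- The graph `(V, E)` is strongly connected. -/
def StronglyConnected {V : Type*} (E : Set (V × V)) : Prop :=
  ∀ u v : V, Relation.ReflTransGen (fun a b => (a, b) ∈ E) u v

/-- `W` is a (nonempty) strongly connected subset of the vertices: any two vertices of `W`
are joined by a directed path staying inside `W`. -/
def StronglyConnectedSub {V : Type*} (E : Set (V × V)) (W : Finset V) : Prop :=
  W.Nonempty ∧ ∀ u ∈ W, ∀ v ∈ W,
    Relation.ReflTransGen (fun a b => a ∈ W ∧ b ∈ W ∧ (a, b) ∈ E) u v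

/-- `P` is a transition matrix associated with the graph `(V, E)`. -/
def IsTransMatrix {V : Type*} [Fintype V] (E : Set (V × V)) (P : Matrix V V ℝ) : Prop :=
  (∀ i j, 0 ≤ P i j) ∧ (∀ i, ∑ j, P i j = 1) ∧ ∀ i j, i ≠ j → (0 < P i j ↔ (i, j) ∈ E)

/-- The lift `P̄` of the matrix `P` to the spanning tree graph. -/
def liftP {V : Type*} [DecidableEq V] (E : Set (V × V)) (P : Matrix V V ℝ) :
    Matrix (STree E) (STree E) ℝ :=
  fun t t' => if t = t' then P t.root t.root
    else if STreeEdge E t t' then P t.root t'.root else 0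

/-- A directed rooted spanning forest of the graph with edge set `E`, rooted in `W`. -/
def IsSpanningForest {V : Type*} (E : Set (V × V)) (W : Finset V) (f : V → V) : Prop :=
  (∀ w ∈ W, f w = w) ∧ (∀ v, v ∉ W → (v, f v) ∈ E) ∧ ∀ v, ∃ n, f^[n] v ∈ W

/-- `k(W)`: the number of spanning forests rooted in `W`. -/
def kForest {V : Type*} (E : Set (V × V)) (W : Finset V) : ℕ :=
  Nat.card {f : V → V // IsSpanningForest E W f}

/-- The `W × W` submatrix of `A` (rows and columns indexed by `W`). -/
def subm {V : Type*} {R : Type*} (A : Matrix V V R) (W : Finset V) : Matrix W W R :=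
  A.submatrix (fun i => (i : V)) (fun j => (j : V))

/-- `Ψ_W`: the sum of the weights of the spanning forests rooted in `W`,
for edge weights `x`. -/
def forestWeightSum {V : Type*} [Fintype V] [DecidableEq V] (E : Set (V × V))
    (x : V → V → ℝ) (W : Finset V) : ℝ :=
  ∑ f ∈ Finset.univ.filter (IsSpanningForest E W),
    ∏ v ∈ Finset.univ.filter (fun v => v ∉ W), x v (f v)

/-- The weight of a spanning tree: product of edge weights over non-root vertices. -/
def treeWeight {V : Type*} [Fintype V] [DecidableEq V] {E : Set (V × V)}
    (x : V → V → ℝ) (t : STree E) : ℝ :=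
  ∏ v ∈ Finset.univ.erase t.root, x v (t.tree v)

/-- `step(t, j)`: move the root of the (rooted function) `p` along the edge to `j`. -/
def stepF {V : Type*} [DecidableEq V] (E : Set (V × V)) (p : (V → V) × V) (j : V) :
    (V → V) × V :=
  if j = p.2 then p
  else if (p.2, j) ∈ E then (Function.update (Function.update p.1 p.2 j) j j, j)
  else p

/-- `traverse(c, p)`: successively apply `step` with the vertices `c 1, c 2, …, c (n-1), c 0`. -/
def traverse {V : Type*} [DecidableEq V] (E : Set (V × V)) (n : ℕ) (c : ZMod n → V)
    (p : (V → V) × V) : (V → V) × V :=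
  (List.range n).foldl (fun q i => stepF E q (c ((i : ZMod n) + 1))) p

theorem my_leibniz_prod {ι : Type*} [DecidableEq ι] (D : Derivation ℝ (PowerSeries ℝ) (PowerSeries ℝ))
    (s : Finset ι) (f : ι → PowerSeries ℝ) :
    D (∏ i ∈ s, f i) = ∑ i ∈ s, ∏ j ∈ s, (if j = i then D (f j) else f j) := by
  induction s using Finset.induction_on with
  | empty => simp
  | insert a s ha ih =>
    rw [Finset.prod_insert ha, Derivation.leibniz, ih, Finset.sum_insert ha, Finset.prod_insert ha]
    simp only [if_true, smul_eq_mul]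
    rw [add_comm]
    congr 1
    · rw [mul_comm]
      congr 1
      apply Finset.prod_congr rfl
      intro j hj
      rw [if_neg (by rintro rfl; exact ha hj)]
    · rw [Finset.mul_sum]
      apply Finset.sum_congr rfl
      intro i hi
      rw [Finset.prod_insert ha, if_neg (by rintro rfl; exact ha hi)]

theorem my_deriv_det {n : Type*} [Fintype n] [DecidableEq n]
    (D : Derivation ℝ (PowerSeries ℝ) (PowerSeries ℝ)) (M : Matrix n n (PowerSeries ℝ)) :
    D M.det = Matrix.trace (M.adjugate * M.map D) := by
  have h1 : D M.det = ∑ j, (M.updateCol j (fun i => D (M i j))).det := by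
    simp only [Matrix.det_apply]
    rw [map_sum, Finset.sum_comm]
    apply Finset.sum_congr rfl
    intro σ _
    rw [Units.smul_def, map_zsmul, my_leibniz_prod, Finset.smul_sum]
    apply Finset.sum_congr rfl
    intro j _
    rw [Units.smul_def]
    congr 1
    apply Finset.prod_congr rfl
    intro i _
    rw [Matrix.updateCol_apply]
    split_ifs with h
    · rw [h]
    · rfl
  rw [h1, Matrix.trace]
  apply Finset.sum_congr rfl
  intro j _
  rw [← Matrix.cramer_apply, Matrix.cramer_eq_adjugate_mulVec]
  simp [Matrix.mulVec, Matrix.mul_apply, dotProduct]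

/-- `f` has logarithmic derivative `-g`. -/
def LogD (f g : PowerSeries ℝ) : Prop :=
  PowerSeries.constantCoeff f = 1 ∧ PowerSeries.derivative ℝ f = -(f * g)

theorem LogD.mul {f g f' g'} (h : LogD f g) (h' : LogD f' g') : LogD (f * f') (g + g') := by
  refine ⟨by simp [h.1, h'.1], ?_⟩
  rw [Derivation.leibniz, h.2, h'.2]
  simp only [smul_eq_mul]
  ring

theorem LogD.one : LogD 1 0 := ⟨by simp, by simp⟩

theorem LogD.pow {f g} (h : LogD f g) (n : ℕ) : LogD (f ^ n) (n • g) := by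
  induction n with
  | zero => simpa using LogD.one
  | succ n ih => rw [pow_succ, succ_nsmul]; exact ih.mul h

theorem LogD.prod {ι : Type*} [DecidableEq ι] (s : Finset ι) (f g : ι → PowerSeries ℝ)
    (h : ∀ i ∈ s, LogD (f i) (g i)) : LogD (∏ i ∈ s, f i) (∑ i ∈ s, g i) := by
  induction s using Finset.induction_on with
  | empty => simpa using LogD.one
  | insert a s ha ih =>
    rw [Finset.prod_insert ha, Finset.sum_insert ha]
    exact (h a (by simp)).mul (ih fun i hi => h i (by simp [hi]))

theorem LogD.unique {f f' g} (h : LogD f g) (h' : LogD f' g) : f = f' := by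
  have h0 : PowerSeries.constantCoeff f' ≠ 0 := by rw [h'.1]; exact one_ne_zero
  have : f * f'⁻¹ = 1 := by
    apply PowerSeries.derivative.ext
    · rw [Derivation.leibniz, PowerSeries.derivative_inv', h.2, h'.2]
      simp only [smul_eq_mul]
      have := PowerSeries.mul_inv_cancel f' h0
      have e : PowerSeries.derivative ℝ (1 : PowerSeries ℝ) = 0 := by simp
      rw [e]
      linear_combination (f * f'⁻¹ * g) * this
    · simp [h.1, h'.1]
  calc f = f * f'⁻¹ * f' := by rw [mul_assoc, PowerSeries.inv_mul_cancel f' h0, mul_one]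
    _ = f' := by rw [this, one_mul]

theorem my_resolvent {n : Type*} [Fintype n] [DecidableEq n] (A : Matrix n n ℝ) :
    (1 - (PowerSeries.X : PowerSeries ℝ) • A.map (PowerSeries.C (R := ℝ))) *
      (Matrix.of fun i j => PowerSeries.mk fun k => (A ^ k) i j) = 1 := by
  rw [sub_mul, one_mul, smul_mul_assoc]
  ext i j k
  cases k with
  | zero =>
    simp [Matrix.one_apply]
  | succ k =>
    simp only [Matrix.sub_apply, Matrix.smul_apply, smul_eq_mul, map_sub, Matrix.of_apply,
      PowerSeries.coeff_mk, PowerSeries.coeff_succ_X_mul, Matrix.mul_apply, map_sum,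
      Matrix.map_apply, PowerSeries.coeff_C_mul]
    rw [pow_succ', Matrix.mul_apply, sub_self, Matrix.one_apply]
    split_ifs <;> simp [PowerSeries.coeff_one]

theorem my_logD_det {n : Type*} [Fintype n] [DecidableEq n] (A : Matrix n n ℝ) :
    LogD (A.charpolyRev : PowerSeries ℝ) (PowerSeries.mk fun k => (A ^ (k + 1)).trace) := by
  set M := (1 - (PowerSeries.X : PowerSeries ℝ) • A.map (PowerSeries.C (R := ℝ))) with hM
  set G := (Matrix.of fun i j => PowerSeries.mk fun k => (A ^ k) i j) with hG
  have hMG : M * G = 1 := my_resolvent A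
  have hdet : (A.charpolyRev : PowerSeries ℝ) = M.det := by
    rw [Matrix.charpolyRev, ← Polynomial.coeToPowerSeries.ringHom_apply, RingHom.map_det]
    congr 1
    ext1 i j
    simp [hM, Matrix.one_apply]
    split_ifs <;> simp [mul_comm]
  refine ⟨?_, ?_⟩
  · rw [Polynomial.constantCoeff_coe, Polynomial.coeff_zero_eq_eval_zero, Matrix.eval_charpolyRev]
  rw [hdet, my_deriv_det]
  have hadj : M.adjugate = M.det • G := by
    calc M.adjugate = M.adjugate * (M * G) := by rw [hMG, mul_one]
      _ = _ := by rw [← mul_assoc, Matrix.adjugate_mul, smul_mul_assoc, one_mul]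
  have hMd : M.map (PowerSeries.derivative ℝ) = -A.map (PowerSeries.C (R := ℝ)) := by
    ext1 i j
    simp only [hM, Matrix.map_apply, Matrix.sub_apply, Matrix.smul_apply, Matrix.neg_apply, map_sub,
      smul_eq_mul, Derivation.leibniz, PowerSeries.derivative_C, PowerSeries.derivative_X,
      Matrix.one_apply]
    split_ifs <;> simp
  rw [hadj, hMd, smul_mul_assoc, Matrix.trace_smul, mul_neg, Matrix.trace_neg, smul_neg, smul_eq_mul]
  congr 2
  ext k
  simp only [Matrix.trace, Matrix.diag, Matrix.mul_apply, map_sum, PowerSeries.coeff_mk, hG,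
    Matrix.of_apply, Matrix.map_apply, PowerSeries.coeff_mul_C, pow_succ]

theorem my_eval_charpolyRev {n : Type*} [Fintype n] [DecidableEq n] (A : Matrix n n ℝ) (s : ℝ) :
    A.charpolyRev.eval s = Matrix.det (1 - s • A) := by
  rw [Matrix.charpolyRev, ← Polynomial.coe_evalRingHom, RingHom.map_det]
  congr 1
  ext i j
  simp [Matrix.one_apply]
  split_ifs <;> simp [mul_comm]

section Walks

variable {V : Type*} [DecidableEq V]

/-- move the root to `j` -/
def stp (p : (V → V) × V) (j : V) : (V → V) × V :=
  (Function.update (Function.update p.1 p.2 j) j j, j)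

/-- successive moves -/
def rn : (V → V) × V → List V → (V → V) × V
  | p, [] => p
  | p, j :: l => rn (stp p j) l

/-- last vertex of a walk -/
def lst : V → List V → V
  | i, [] => i
  | _, j :: l => lst j l

/-- weight of a walk -/
def wt (P : Matrix V V ℝ) : V → List V → ℝ
  | _, [] => 1
  | i, j :: l => P i j * wt P j l

/-- all steps of the walk are legal -/
def okw (E : Set (V × V)) : V → List V → Prop
  | _, [] => True
  | i, j :: l => (i = j ∨ (i, j) ∈ E) ∧ okw E j l

/-- tree on the vertex subset `S` -/
def PInv (E : Set (V × V)) (S : Set V) (p : (V → V) × V) : Prop :=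
  p.2 ∈ S ∧ p.1 p.2 = p.2 ∧ (∀ v ∈ S, v ≠ p.2 → (v, p.1 v) ∈ E) ∧ (∀ v ∈ S, p.1 v ∈ S) ∧
    ∀ v ∈ S, ∃ n, p.1^[n] v = p.2

theorem okw_of_wt [Fintype V] {E : Set (V × V)} {P : Matrix V V ℝ} (hP : IsTransMatrix E P) (i : V)
    (l : List V) (h : wt P i l ≠ 0) : okw E i l := by
  induction l generalizing i with
  | nil => trivial
  | cons j l ih =>
    rw [wt] at h
    refine ⟨?_, ih j (right_ne_zero_of_mul h)⟩
    by_cases hij : i = j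
    · exact Or.inl hij
    · exact Or.inr ((hP.2.2 i j hij).1 (lt_of_le_of_ne (hP.1 i j) (left_ne_zero_of_mul h).symm))

theorem stp_root (p : (V → V) × V) (h : p.1 p.2 = p.2) : stp p p.2 = p := by
  ext1
  · ext v
    by_cases hv : v = p.2
    · subst hv; simp [stp, h]
    · simp [stp, hv]
  · rfl

theorem rn_snd (p : (V → V) × V) (l : List V) : (rn p l).2 = lst p.2 l := by
  induction l generalizing p with
  | nil => rfl
  | cons j l ih => rw [rn, ih]; rfl

theorem lst_mem (i : V) (l : List V) (h : l ≠ []) : lst i l ∈ l := by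
  induction l generalizing i with
  | nil => exact absurd rfl h
  | cons j l ih =>
    by_cases hl : l = []
    · subst hl; simp [lst]
    · exact List.mem_cons_of_mem _ (ih j hl)

theorem stp_reach {f : V → V} {r j : V} (n : ℕ) : ∀ v, f^[n] v = r →
    ∃ m, (stp (f, r) j).1^[m] v = j := by
  have hr : ∃ m, (stp (f, r) j).1^[m] r = j := by
    by_cases h : r = j
    · exact ⟨0, h⟩
    · exact ⟨1, by simp [stp, h]⟩
  induction n with
  | zero => rintro v rfl; exact hr
  | succ n ih =>
    intro v hv
    by_cases hvr : v = r
    · rw [hvr]; exact hr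
    by_cases hvj : v = j
    · exact ⟨0, hvj⟩
    obtain ⟨m, hm⟩ := ih (f v) (by simpa using hv)
    refine ⟨m + 1, ?_⟩
    rw [Function.iterate_succ_apply]
    rwa [show (stp (f, r) j).1 v = f v by simp [stp, hvr, hvj]]

theorem PInv.stp {E : Set (V × V)} {S : Set V} {p : (V → V) × V} (h : PInv E S p) {j : V}
    (hj : p.2 = j ∨ (p.2, j) ∈ E) : PInv E (insert j S) (stp p j) := by
  obtain ⟨h1, h2, h3, h4, h5⟩ := h
  refine ⟨by simp [_root_.stp], by simp [_root_.stp], ?_, ?_, ?_⟩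
  · intro v hv hvj
    have hvj' : v ≠ j := hvj
    have hvS : v ∈ S := hv.resolve_left hvj'
    by_cases hvr : v = p.2
    · subst hvr
      simpa [_root_.stp, hvj'] using hj.resolve_left hvj'
    · simpa [_root_.stp, hvj', hvr] using h3 v hvS hvr
  · intro v hv
    by_cases hvj' : v = j
    · subst hvj'; simp [_root_.stp]
    have hvS : v ∈ S := hv.resolve_left hvj'
    by_cases hvr : v = p.2
    · subst hvr
      simp [_root_.stp, hvj']
    · simpa [_root_.stp, hvj', hvr] using Or.inr (h4 v hvS)
  · intro v hv
    by_cases hvj' : v = j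
    · exact ⟨0, hvj'⟩
    have hvS : v ∈ S := hv.resolve_left hvj'
    obtain ⟨n, hn⟩ := h5 v hvS
    exact stp_reach (f := p.1) (r := p.2) n v hn

theorem PInv.rn {E : Set (V × V)} {S : Set V} {p : (V → V) × V} (h : PInv E S p) {l : List V}
    (hl : okw E p.2 l) : PInv E (S ∪ {v | v ∈ l}) (rn p l) := by
  induction l generalizing p S with
  | nil => simpa [_root_.rn] using h
  | cons j l ih =>
    have := ih (h.stp hl.1) hl.2
    rw [_root_.rn]
    convert this using 1
    ext v
    simp
    tauto

theorem inv_univ_iff {E : Set (V × V)} {p : (V → V) × V} :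
    PInv E Set.univ p ↔ IsSpanningTree E p.2 p.1 := by
  simp [PInv, IsSpanningTree]

theorem rn_out (p : (V → V) × V) (l : List V) (v : V) (hv : v ≠ p.2) (hl : v ∉ l) :
    (rn p l).1 v = p.1 v := by
  induction l generalizing p with
  | nil => rfl
  | cons j l ih =>
    simp at hl
    rw [rn, ih (stp p j) hl.1 hl.2]
    simp [stp, hv, hl.1]

theorem rn_agree (p q : (V → V) × V) (hpq : p.2 = q.2) (S : Set V) (hS : p.2 ∈ S)
    (h : ∀ v ∈ S, p.1 v = q.1 v) (l : List V) (v : V) (hv : v ∈ S ∨ v ∈ l) :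
    (rn p l).1 v = (rn q l).1 v := by
  induction l generalizing p q S with
  | nil => simp at hv; exact h v hv
  | cons j l ih =>
    rw [rn, rn]
    apply ih (stp p j) (stp q j) rfl (insert j S) (by simp [stp])
    · intro w hw
      by_cases hwj : w = j
      · subst hwj; simp [stp]
      have hwS : w ∈ S := hw.resolve_left hwj
      by_cases hwr : w = p.2
      · have hwj2 : q.2 ≠ j := hpq ▸ hwr ▸ hwj
        simp [stp, hwr, hpq, hwj2]
      · simp [stp, hwj, hwr, hpq ▸ hwr, h w hwS]
    · simp at hv ⊢
      tauto

theorem walk_from {E : Set (V × V)} (W : Finset V) (i : V) (l : List V) (hl : okw E i l)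
    (hi : i ∈ W) (hW : ∀ v ∈ l, v ∈ W) (v : V) (hv : v ∈ l) :
    Relation.ReflTransGen (fun a b => a ∈ W ∧ b ∈ W ∧ (a, b) ∈ E) i v := by
  induction l generalizing i with
  | nil => simp at hv
  | cons j l ih =>
    have hj : j ∈ W := hW j (by simp)
    have h1 : Relation.ReflTransGen (fun a b => a ∈ W ∧ b ∈ W ∧ (a, b) ∈ E) i j := by
      rcases hl.1 with h | h
      · rw [h]
      · exact Relation.ReflTransGen.single ⟨hi, hj, h⟩
    rcases List.mem_cons.1 hv with h | h
    · rw [h]; exact h1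
    · exact h1.trans (ih j hl.2 hj (fun v hv => hW v (by simp [hv])) h)

theorem walk_to {E : Set (V × V)} (W : Finset V) (i : V) (l : List V) (hl : okw E i l)
    (hi : i ∈ W) (hW : ∀ v ∈ l, v ∈ W) (v : V) (hv : v = i ∨ v ∈ l) :
    Relation.ReflTransGen (fun a b => a ∈ W ∧ b ∈ W ∧ (a, b) ∈ E) v (lst i l) := by
  induction l generalizing i v with
  | nil => simp at hv; rw [hv]; rfl
  | cons j l ih =>
    have hj : j ∈ W := hW j (by simp)
    have h1 : Relation.ReflTransGen (fun a b => a ∈ W ∧ b ∈ W ∧ (a, b) ∈ E) i j := by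
      rcases hl.1 with h | h
      · rw [h]
      · exact Relation.ReflTransGen.single ⟨hi, hj, h⟩
    have ih' := ih j hl.2 hj (fun v hv => hW v (by simp [hv]))
    rcases hv with h | h
    · rw [h]; exact h1.trans (ih' j (Or.inl rfl))
    · exact ih' v (List.mem_cons.1 h)

theorem supp_sc {E : Set (V × V)} (i : V) (l : List V) (hl : okw E i l) (hne : l ≠ [])
    (hlst : lst i l = i) : StronglyConnectedSub E l.toFinset := by
  have hi : i ∈ l := hlst ▸ lst_mem i l hne
  refine ⟨⟨i, by simpa using hi⟩, ?_⟩
  intro u hu v hv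
  have h1 := walk_to l.toFinset i l hl (by simpa using hi) (by simp) u (Or.inr (by simpa using hu))
  have h2 := walk_from l.toFinset i l hl (by simpa using hi) (by simp) v (by simpa using hv)
  rw [hlst] at h1
  exact h1.trans h2

/-- glue a tree on `W` with a forest rooted in `W` -/
def glue (W : Finset V) (g f : V → V) : V → V := fun v => if v ∈ W then g v else f v

theorem iter_in (W : Finset V) (g f : V → V) (hg : ∀ v ∈ W, g v ∈ W) (n : ℕ) :
    ∀ v ∈ W, (glue W g f)^[n] v = g^[n] v := by
  induction n with
  | zero => intro v _; rfl
  | succ n ih =>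
    intro v hv
    rw [Function.iterate_succ_apply, Function.iterate_succ_apply]
    rw [show glue W g f v = g v by simp [glue, hv], ih _ (hg v hv)]

theorem iter_out (W : Finset V) (f f' : V → V) (hf : ∀ v, v ∉ W → f' v = f v) (n : ℕ) :
    ∀ v, f^[n] v ∈ W → ∃ m, (f')^[m] v ∈ W := by
  induction n with
  | zero => intro v hv; exact ⟨0, hv⟩
  | succ n ih =>
    intro v hv
    by_cases hvW : v ∈ W
    · exact ⟨0, hvW⟩
    obtain ⟨m, hm⟩ := ih (f v) (by simpa using hv)
    exact ⟨m + 1, by rwa [Function.iterate_succ_apply, hf v hvW]⟩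

theorem count_fixed [Fintype V] {E : Set (V × V)} (i : V) (l : List V) (hl : okw E i l)
    (hne : l ≠ []) (hlst : lst i l = i) :
    Nat.card {t : STree E // t.root = i ∧ rn t.1 l = t.1} = kForest E l.toFinset := by
  have hi : i ∈ l := hlst ▸ lst_mem i l hne
  have hInv0 : PInv E {i} (id, i) := by simp [PInv]
  obtain ⟨h1, h2, h3, h4, h5⟩ := hInv0.rn (l := l) hl
  have hset : ({i} ∪ {v | v ∈ l} : Set V) = {v | v ∈ l} := by
    ext v; simp; rintro rfl; exact hi
  rw [hset] at h1 h3 h4 h5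
  have hroot : (rn ((id : V → V), i) l).2 = i := by rw [rn_snd]; exact hlst
  rw [hroot] at h1 h2 h3 h5
  set g := (rn ((id : V → V), i) l).1 with hg
  have hfix : ∀ p : (V → V) × V, p.1 p.2 = p.2 → p.2 = i →
      (rn p l = p ↔ ∀ v ∈ l, p.1 v = g v) := by
    intro p hp hpi
    have hag : ∀ v ∈ l, (rn p l).1 v = g v := by
      intro v hv
      apply rn_agree p (id, i) hpi {i} hpi _ l v (Or.inr hv)
      rintro w rfl
      rw [← hpi, hp]; rfl
    constructor
    · intro h v hv
      rw [← hag v hv, h]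
    · intro h
      ext1
      · ext1 v
        by_cases hv : v ∈ l
        · rw [hag v hv, h v hv]
        · exact rn_out p l v (by rintro rfl; exact hv (hpi ▸ hi)) hv
      · rw [rn_snd, hpi, hlst]
  unfold kForest
  set W := l.toFinset with hW
  have hmW : ∀ v, v ∈ W ↔ v ∈ l := by simp [hW]
  apply Nat.card_congr
  refine ⟨fun t => ⟨glue W id t.1.tree, ?_⟩, fun f => ⟨⟨(glue W g f.1, i), ?_⟩, rfl, ?_⟩, ?_, ?_⟩
  · obtain ⟨⟨⟨t, r⟩, ht1, ht2, ht3⟩, hr, ht⟩ := t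
    change r = i at hr
    subst hr
    refine ⟨fun w hw => by simp [glue, hw], ?_, ?_⟩
    · intro v hv
      have : v ≠ r := by rintro rfl; exact hv ((hmW _).2 hi)
      simpa [glue, hv, STree.tree] using ht2 v this
    · intro v
      obtain ⟨n, hn⟩ := ht3 v
      exact iter_out W t (glue W id t) (fun v hv => by simp [glue, hv]) n v
        (hn ▸ (hmW _).2 hi)
  · obtain ⟨f, hf1, hf2, hf3⟩ := f
    refine ⟨?_, ?_, ?_⟩
    · simpa [glue, (hmW i).2 hi] using h2
    · intro v hv
      by_cases hvW : v ∈ W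
      · simpa [glue, hvW] using h3 v ((hmW v).1 hvW) hv
      · simpa [glue, hvW] using hf2 v hvW
    · intro v
      obtain ⟨n, hn⟩ := hf3 v
      obtain ⟨m, hm⟩ := iter_out W f (glue W g f) (fun v hv => by simp [glue, hv]) n v hn
      obtain ⟨k, hk⟩ := h5 _ ((hmW _).1 hm)
      refine ⟨k + m, ?_⟩
      rw [Function.iterate_add_apply]
      show (glue W g f)^[k] ((glue W g f)^[m] v) = i
      rw [iter_in W g f (fun v hv => (hmW _).2 (h4 v ((hmW _).1 hv))) k _ hm, hk]
  · rw [hfix]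
    · intro v hv
      simp [glue, (hmW v).2 hv]
    · simpa [glue, (hmW i).2 hi] using h2
    · rfl
  · intro t
    obtain ⟨⟨⟨t, r⟩, ht1, ht2, ht3⟩, hr, ht⟩ := t
    change r = i at hr
    subst hr
    apply Subtype.ext
    apply Subtype.ext
    ext1
    · ext1 v
      have := (hfix (t, r) ht1 rfl).1 ht
      by_cases hv : v ∈ W
      · simpa [glue, hv] using (this v ((hmW v).1 hv)).symm
      · simp [glue, hv, STree.tree]
    · rfl
  · intro f
    obtain ⟨f, hf1, hf2, hf3⟩ := f
    apply Subtype.ext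
    ext1 v
    by_cases hv : v ∈ W
    · simp [glue, hv, hf1 v hv]
    · simp [glue, hv, STree.tree]

end Walks

section Traces

variable {V : Type*} [Fintype V] [DecidableEq V]

theorem my_sum_ofFn (n : ℕ) (F : List V → ℝ) :
    ∑ c : Fin (n + 1) → V, F (List.ofFn c) =
      ∑ j : V, ∑ c : Fin n → V, F (j :: List.ofFn c) := by
  rw [← Fintype.sum_prod_type']
  rw [← (Fin.consEquiv (fun _ : Fin (n + 1) => V)).sum_comp]
  apply Finset.sum_congr rfl
  rintro ⟨j, c⟩ _
  simp [Fin.consEquiv, List.ofFn_succ]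

theorem liftP_eq {E : Set (V × V)} {P : Matrix V V ℝ} (hP : IsTransMatrix E P) (t u : STree E) :
    liftP E P t u = if u.1 = stp t.1 u.root then P t.root u.root else 0 := by
  unfold liftP
  by_cases htu : t = u
  · subst htu
    have : t.1 = stp t.1 t.root := (stp_root t.1 t.2.1).symm
    rw [if_pos rfl, if_pos this]
  rw [if_neg htu]
  by_cases h : u.1 = stp t.1 u.root
  · rw [if_pos h]
    have hr : t.root ≠ u.root := by
      intro hr
      apply htu
      apply Subtype.ext
      rw [h, ← hr]
      exact (stp_root t.1 t.2.1).symm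
    by_cases he : (t.root, u.root) ∈ E
    · rw [if_pos ⟨hr, he, congrArg Prod.fst h⟩]
    · rw [if_neg fun h => he h.2.1]
      by_contra hne
      exact he ((hP.2.2 _ _ hr).1 (lt_of_le_of_ne (hP.1 _ _) hne))
  · rw [if_neg h, if_neg]
    rintro ⟨_, _, h3⟩
    exact h (Prod.ext h3 rfl)

theorem liftP_sum {E : Set (V × V)} {P : Matrix V V ℝ} (hP : IsTransMatrix E P) (t : STree E)
    (F : (V → V) × V → ℝ) :
    ∑ u, liftP E P t u * F u.1 = ∑ j, P t.root j * F (stp t.1 j) := by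
  have h1 : ∀ j, P t.root j * F (stp t.1 j) =
      ∑ u : STree E, if u.1 = stp t.1 j then P t.root j * F u.1 else 0 := by
    intro j
    by_cases hj : P t.root j = 0
    · simp [hj]
    have hok : t.1.2 = j ∨ (t.1.2, j) ∈ E :=
      (okw_of_wt hP t.root [j] (by simpa [wt] using hj)).1
    have hinv : PInv E Set.univ (stp t.1 j) := by
      have := PInv.stp (inv_univ_iff.2 t.2) hok
      simpa using this
    rw [Finset.sum_eq_single (⟨stp t.1 j, inv_univ_iff.1 hinv⟩ : STree E)]
    · simp
    · intro b _ hb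
      rw [if_neg]
      exact fun h => hb (Subtype.ext h)
    · simp
  simp_rw [h1]
  rw [Finset.sum_comm]
  apply Finset.sum_congr rfl
  intro u _
  rw [liftP_eq hP, Finset.sum_eq_single u.root]
  · split_ifs <;> simp
  · intro j _ hj
    rw [if_neg]
    intro h
    exact hj (congrArg Prod.snd h).symm
  · simp

theorem liftP_pow {E : Set (V × V)} {P : Matrix V V ℝ} (hP : IsTransMatrix E P) (n : ℕ)
    (t t' : STree E) :
    (liftP E P ^ n) t t' = ∑ c : Fin n → V, wt P t.root (List.ofFn c) *
      if rn t.1 (List.ofFn c) = t'.1 then 1 else 0 := by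
  induction n generalizing t with
  | zero =>
    simp [wt, rn, Matrix.one_apply, Subtype.ext_iff]
  | succ n ih =>
    rw [pow_succ', Matrix.mul_apply]
    simp_rw [ih]
    have := liftP_sum hP t (fun p => ∑ c : Fin n → V, wt P p.2 (List.ofFn c) *
      if rn p (List.ofFn c) = t'.1 then 1 else 0)
    refine this.trans ?_
    rw [my_sum_ofFn n (fun l => wt P t.root l * if rn t.1 l = t'.1 then 1 else 0)]
    apply Finset.sum_congr rfl
    intro j _
    rw [Finset.mul_sum]
    apply Finset.sum_congr rfl
    intro c _
    rw [wt, rn, mul_assoc]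
    rfl

theorem subm_pow (P : Matrix V V ℝ) (W : Finset V) (n : ℕ) (i j : W) :
    (subm P W ^ n) i j = ∑ c : Fin n → V, wt P i (List.ofFn c) *
      if lst (i : V) (List.ofFn c) = j ∧ (∀ v ∈ List.ofFn c, v ∈ W) then 1 else 0 := by
  induction n generalizing i with
  | zero =>
    simp [wt, lst, Matrix.one_apply]
  | succ n ih =>
    rw [pow_succ', Matrix.mul_apply]
    simp_rw [ih]
    rw [my_sum_ofFn n (fun l => wt P i l *
      if lst (i : V) l = j ∧ (∀ v ∈ l, v ∈ W) then 1 else 0)]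
    have hsub : ∑ x : W, subm P W i x * ∑ c : Fin n → V, wt P x (List.ofFn c) *
          (if lst (x : V) (List.ofFn c) = j ∧ (∀ v ∈ List.ofFn c, v ∈ W) then 1 else 0)
        = ∑ x ∈ W, P i x * ∑ c : Fin n → V, wt P x (List.ofFn c) *
          (if lst (x : V) (List.ofFn c) = j ∧ (∀ v ∈ List.ofFn c, v ∈ W) then 1 else 0) := by
      rw [← Finset.sum_coe_sort W]
      rfl
    rw [hsub]
    rw [← Finset.sum_subset (Finset.subset_univ W)]
    · apply Finset.sum_congr rfl
      intro x hx
      rw [Finset.mul_sum]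
      apply Finset.sum_congr rfl
      intro c _
      rw [wt, lst, mul_assoc]
      simp only [List.mem_cons, forall_eq_or_imp, hx, true_and]
    · intro x _ hx
      apply Finset.sum_eq_zero
      intro c _
      simp [hx]

/-- indicator of closed walks in `W` -/
def clw (P : Matrix V V ℝ) (W : Finset V) (i : V) (l : List V) : ℝ :=
  wt P i l * if lst i l = i ∧ (∀ v ∈ l, v ∈ W) then 1 else 0

theorem subm_trace (P : Matrix V V ℝ) (W : Finset V) (n : ℕ) :
    (subm P W ^ (n + 1)).trace = ∑ i : V, ∑ c : Fin (n + 1) → V, clw P W i (List.ofFn c) := by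
  rw [Matrix.trace]
  simp only [Matrix.diag, subm_pow]
  rw [← Finset.sum_subset (Finset.subset_univ W)]
  · rw [← Finset.sum_coe_sort W]
    rfl
  · intro i _ hi
    apply Finset.sum_eq_zero
    intro c _
    rw [clw, if_neg, mul_zero]
    rintro ⟨h1, h2⟩
    exact hi (h2 i (h1 ▸ lst_mem i _ (by simp)))

theorem count_fixed' {E : Set (V × V)} (i : V) (l : List V) (hl : okw E i l)
    (hne : l ≠ []) :
    ∑ t : STree E, (if t.root = i ∧ rn t.1 l = t.1 then 1 else 0 : ℝ)
      = if lst i l = i then (kForest E l.toFinset : ℝ) else 0 := by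
  split_ifs with h
  · rw [← count_fixed i l hl hne h, Finset.sum_boole, Nat.card_eq_fintype_card, Fintype.card_subtype]
  · apply Finset.sum_eq_zero
    intro t _
    rw [if_neg]
    rintro ⟨h1, h2⟩
    apply h
    have := rn_snd t.1 l
    rw [h2] at this
    change t.root = lst t.root l at this
    rw [h1] at this
    exact this.symm

theorem liftP_trace {E : Set (V × V)} {P : Matrix V V ℝ} (hP : IsTransMatrix E P) (n : ℕ)
    (m : Finset V → ℤ)
    (hm : ∀ W, StronglyConnectedSub E W → (kForest E W : ℤ) =
      ∑ W' ∈ Finset.univ.filter (fun W' => StronglyConnectedSub E W' ∧ W ⊆ W'), m W') :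
    (liftP E P ^ (n + 1)).trace =
      ∑ W ∈ Finset.univ.filter (fun W : Finset V => StronglyConnectedSub E W),
        (m W : ℝ) * (subm P W ^ (n + 1)).trace := by
  have h1 : (liftP E P ^ (n + 1)).trace = ∑ i : V, ∑ c : Fin (n + 1) → V,
      wt P i (List.ofFn c) * ∑ t : STree E,
        (if t.root = i ∧ rn t.1 (List.ofFn c) = t.1 then 1 else 0 : ℝ) := by
    rw [Matrix.trace]
    simp only [Matrix.diag, liftP_pow hP]
    simp_rw [Finset.mul_sum]
    rw [Finset.sum_comm, Finset.sum_comm (s := (Finset.univ : Finset V))]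
    apply Finset.sum_congr rfl
    intro c _
    rw [Finset.sum_comm]
    apply Finset.sum_congr rfl
    intro t _
    rw [Finset.sum_eq_single t.root]
    · simp
    · intro i _ hi
      rw [if_neg, mul_zero]
      exact fun h => hi h.1.symm
    · simp
  rw [h1]
  simp_rw [subm_trace, Finset.mul_sum (s := (Finset.univ : Finset V))]
  rw [Finset.sum_comm (t := (Finset.univ : Finset V))]
  apply Finset.sum_congr rfl
  intro i _
  simp_rw [Finset.mul_sum (s := (Finset.univ : Finset (Fin (n+1) → V)))]
  rw [Finset.sum_comm (t := (Finset.univ : Finset (Fin (n+1) → V)))]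
  apply Finset.sum_congr rfl
  intro c _
  have hne : List.ofFn c ≠ [] := by simp
  generalize List.ofFn c = l at hne
  simp only [clw]
  by_cases hw : wt P i l = 0
  · simp [hw]
  have hok := okw_of_wt hP i l hw
  rw [count_fixed' i l hok hne]
  by_cases hl : lst i l = i
  · rw [if_pos hl]
    have := hm _ (supp_sc i l hok hne hl)
    have h2 : (kForest E l.toFinset : ℝ) = ∑ W' ∈ Finset.univ.filter
        (fun W' => StronglyConnectedSub E W' ∧ l.toFinset ⊆ W'), (m W' : ℝ) := by
      exact_mod_cast this
    rw [h2, ← Finset.filter_filter, Finset.sum_filter, Finset.mul_sum]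
    apply Finset.sum_congr rfl
    intro W _
    have : l.toFinset ⊆ W ↔ ∀ v ∈ l, v ∈ W := by simp [Finset.subset_iff]
    simp only [this, hl, true_and]
    split_ifs <;> ring
  · simp [hl]

end Traces

/-- the ratio `R(s) = det(1 - s•P̄)/det(1 - s•P)` equals
`∏_W det((1-s•P)|_W)^{m'(W)}` over strongly connected proper subsets `W ⊊ V`. -/
theorem stmt0 {V : Type*} [Fintype V] [DecidableEq V] [Nonempty V]
    (E : Set (V × V)) (hloop : ∀ v : V, (v, v) ∉ E) (hconn : StronglyConnected E)
    (P : Matrix V V ℝ) (hP : IsTransMatrix E P)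
    (m' : Finset V → ℤ)
    (hm'univ : m' Finset.univ = 1)
    (hm' : ∀ W : Finset V, StronglyConnectedSub E W → W ≠ Finset.univ →
      m' W = (kForest E W : ℤ) -
        ∑ W' ∈ Finset.univ.filter (fun W' => StronglyConnectedSub E W' ∧ W ⊂ W'), m' W')
    (s : ℝ) :
    Matrix.det (1 - s • liftP E P) *
      ∏ W ∈ Finset.univ.filter (fun W : Finset V =>
          StronglyConnectedSub E W ∧ W ≠ Finset.univ),
        Matrix.det (subm (1 - s • P) W) ^ (-(m' W)).toNat
    = Matrix.det (1 - s • P) *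
      ∏ W ∈ Finset.univ.filter (fun W : Finset V =>
          StronglyConnectedSub E W ∧ W ≠ Finset.univ),
        Matrix.det (subm (1 - s • P) W) ^ (m' W).toNat := by
  have hscu : StronglyConnectedSub E Finset.univ := by
    refine ⟨Finset.univ_nonempty, fun u _ v _ => ?_⟩
    simpa using hconn u v
  have hm : ∀ W, StronglyConnectedSub E W → (kForest E W : ℤ) =
      ∑ W' ∈ Finset.univ.filter (fun W' => StronglyConnectedSub E W' ∧ W ⊆ W'), m' W' := by
    intro W hW
    have hsplit : Finset.univ.filter (fun W' => StronglyConnectedSub E W' ∧ W ⊆ W') =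
        insert W (Finset.univ.filter (fun W' => StronglyConnectedSub E W' ∧ W ⊂ W')) := by
      ext W'
      simp only [Finset.mem_filter, Finset.mem_univ, true_and, Finset.mem_insert]
      constructor
      · rintro ⟨h1, h2⟩
        rcases eq_or_ne W W' with h | h
        · exact Or.inl h.symm
        · exact Or.inr ⟨h1, lt_of_le_of_ne h2 h⟩
      · rintro (rfl | ⟨h1, h2⟩)
        · exact ⟨hW, subset_rfl⟩
        · exact ⟨h1, h2.1⟩
    rw [hsplit, Finset.sum_insert (by simp)]
    by_cases hu : W = Finset.univ
    · subst hu
      have hk : kForest E (Finset.univ : Finset V) = 1 := by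
        unfold kForest
        rw [Nat.card_eq_one_iff_unique]
        refine ⟨⟨fun f g => Subtype.ext (funext fun v => ?_)⟩,
          ⟨id, by simp, by simp, fun v => ⟨0, by simp⟩⟩⟩
        rw [f.2.1 v (by simp), g.2.1 v (by simp)]
      have he : Finset.univ.filter
          (fun W' => StronglyConnectedSub E W' ∧ Finset.univ ⊂ W') = ∅ := by
        ext W'
        simp only [Finset.mem_filter, Finset.notMem_empty, iff_false]
        rintro ⟨_, _, h⟩
        exact h.2 (Finset.subset_univ _)
      rw [hk, hm'univ, he]
      simp
    · rw [hm' W hW hu]; ring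
  have htr := fun n => liftP_trace hP n m' hm
  have hsub : ∀ W : Finset V, Matrix.det (subm (1 - s • P) W) = (subm P W).charpolyRev.eval s := by
    intro W
    rw [my_eval_charpolyRev]
    congr 1
    ext i j
    simp [subm, Matrix.one_apply]
  have huniv : Matrix.det (1 - s • P) = (subm P Finset.univ).charpolyRev.eval s := by
    rw [← hsub]
    exact (Matrix.det_submatrix_equiv_self
      (Equiv.subtypeUnivEquiv (p := fun x => x ∈ (Finset.univ : Finset V)) (by simp)) _).symm
  rw [huniv]
  simp_rw [hsub]
  rw [← my_eval_charpolyRev]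
  simp only [← Polynomial.eval_pow, ← Polynomial.eval_prod, ← Polynomial.eval_mul]
  congr 1
  apply Polynomial.coe_injective
  simp only [← Polynomial.coeToPowerSeries.ringHom_apply, map_mul, map_prod, map_pow]
  simp only [Polynomial.coeToPowerSeries.ringHom_apply]
  refine LogD.unique ((my_logD_det _).mul (LogD.prod _ (fun W => ((subm P W).charpolyRev : PowerSeries ℝ) ^ (-(m' W)).toNat)
    (fun W => (-(m' W)).toNat • PowerSeries.mk fun k => (subm P W ^ (k + 1)).trace)
    fun W _ => (my_logD_det _).pow _)) ?_
  convert ((my_logD_det _).mul (LogD.prod _ (fun W => ((subm P W).charpolyRev : PowerSeries ℝ) ^ (m' W).toNat)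
    (fun W => (m' W).toNat • PowerSeries.mk fun k => (subm P W ^ (k + 1)).trace)
    fun W _ => (my_logD_det _).pow _)) using 1
  ext k
  simp only [map_add, map_sum, map_nsmul, PowerSeries.coeff_mk]
  rw [htr k]
  have hsplit : Finset.univ.filter (fun W : Finset V => StronglyConnectedSub E W) =
      insert Finset.univ (Finset.univ.filter (fun W : Finset V =>
          StronglyConnectedSub E W ∧ W ≠ Finset.univ)) := by
    ext W
    by_cases h : W = Finset.univ
    · simp [h, hscu]
    · simp [h]
  rw [hsplit, Finset.sum_insert (by simp), hm'univ, Int.cast_one, one_mul, add_assoc,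
    ← Finset.sum_add_distrib]
  congr 1
  apply Finset.sum_congr rfl
  intro W _
  have hz : (((m' W).toNat : ℤ) : ℝ) - ((((-(m' W)).toNat : ℕ) : ℤ) : ℝ) = (m' W : ℝ) := by
    rw [← Int.cast_sub, Int.toNat_sub_toNat_neg]
  rw [← hz]
  simp only [nsmul_eq_mul, Int.cast_natCast]
  ring
end
end

section
/- Let P be a transition matrix associated with G, let n ≥ 1, and let c : ZMod n → V be a cycle in P, i.e. P (c k) (c (k+1)) > 0 for every k; let W be the vertex set (range) of c. Then the number of spanning trees t of G rooted at c 0 such that traverse(c, t) = t equals k(W), the number of spanning forests of G rooted in W. Consequently, the number of cycles of the lifted chain P̄ that project (by taking roots) to the cycle c equals k(W). -/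
open Matrix Finset Classical

noncomputable section

theorem aux_reach_agree {V : Type*} (W : Finset V) (f g : V → V)
    (h : ∀ v, v ∉ W → g v = f v) (m : ℕ) : ∀ v, f^[m] v ∈ W → ∃ k, g^[k] v ∈ W := by
  induction m with
  | zero => intro v hv; exact ⟨0, hv⟩
  | succ m ih =>
    intro v hv
    by_cases hW : v ∈ W
    · exact ⟨0, hW⟩
    · obtain ⟨k, hk⟩ := ih (f v) hv
      refine ⟨k + 1, ?_⟩
      rw [Function.iterate_succ_apply, h v hW]
      exact hk

theorem aux_reach_step {V : Type*} [DecidableEq V] (g : V → V) (i j : V) (m : ℕ) :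
    ∀ v, g^[m] v = i → ∃ k, (Function.update (Function.update g i j) j j)^[k] v = j := by
  induction m with
  | zero =>
    intro v hv
    refine ⟨1, ?_⟩
    have : v = i := hv
    subst this
    by_cases h : v = j
    · subst h; simp
    · simp [Function.update_of_ne h]
  | succ m ih =>
    intro v hv
    by_cases h : v = j
    · exact ⟨0, h⟩
    by_cases h2 : v = i
    · subst h2
      exact ⟨1, by simp [Function.update_of_ne h]⟩
    obtain ⟨k, hk⟩ := ih (g v) hv
    refine ⟨k + 1, ?_⟩
    rw [Function.iterate_succ_apply, Function.update_of_ne h, Function.update_of_ne h2]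
    exact hk

theorem aux_tree_step {V : Type*} [DecidableEq V] (E : Set (V × V)) (g : V → V) (i j : V)
    (hE : (i, j) ∈ E) (h : IsSpanningTree E i g) :
    IsSpanningTree E j (Function.update (Function.update g i j) j j) := by
  refine ⟨by simp, ?_, ?_⟩
  · intro v hv
    rw [Function.update_of_ne hv]
    by_cases h2 : v = i
    · subst h2; simpa using hE
    · rw [Function.update_of_ne h2]; exact h.2.1 v h2
  · intro v
    obtain ⟨m, hm⟩ := h.2.2 v
    exact aux_reach_step g i j m v hm

def auxQ {V : Type*} [DecidableEq V] (E : Set (V × V)) (n : ℕ) (c : ZMod n → V)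
    (p : (V → V) × V) (m : ℕ) : (V → V) × V :=
  (List.range m).foldl (fun q i => stepF E q (c ((i : ZMod n) + 1))) p

theorem auxQ_zero {V : Type*} [DecidableEq V] (E : Set (V × V)) (n : ℕ) (c : ZMod n → V)
    (p : (V → V) × V) : auxQ E n c p 0 = p := rfl

theorem auxQ_succ {V : Type*} [DecidableEq V] (E : Set (V × V)) (n : ℕ) (c : ZMod n → V)
    (p : (V → V) × V) (m : ℕ) :
    auxQ E n c p (m + 1) = stepF E (auxQ E n c p m) (c ((m : ZMod n) + 1)) := by
  simp [auxQ, List.range_succ]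

theorem aux_step {V : Type*} [DecidableEq V] (E : Set (V × V)) (p : (V → V) × V) (j : V)
    (h : p.2 ≠ j → (p.2, j) ∈ E) (hp : p.1 p.2 = p.2) :
    stepF E p j = (Function.update (Function.update p.1 p.2 j) j j, j) := by
  unfold stepF
  by_cases h1 : j = p.2
  · subst h1
    rw [if_pos rfl]
    ext1
    · funext v
      by_cases hv : v = p.2
      · subst hv; simp [hp]
      · simp [Function.update_of_ne hv]
    · rfl
  · rw [if_neg h1, if_pos (h (Ne.symm h1))]

theorem auxQ_root {V : Type*} [DecidableEq V] (E : Set (V × V)) (n : ℕ) (c : ZMod n → V)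
    (hE : ∀ k, c k ≠ c (k + 1) → (c k, c (k + 1)) ∈ E) (t : V → V) (ht : t (c 0) = c 0) (m : ℕ) :
    (auxQ E n c (t, c 0) m).2 = c m ∧ (auxQ E n c (t, c 0) m).1 (c m) = c m := by
  induction m with
  | zero => simpa [auxQ_zero] using ht
  | succ m ih =>
    obtain ⟨h1, h2⟩ := ih
    rw [auxQ_succ, aux_step _ _ _ (by rw [h1]; exact hE _) (by rw [h1]; exact h2)]
    simp

theorem auxQ_succ' {V : Type*} [DecidableEq V] (E : Set (V × V)) (n : ℕ) (c : ZMod n → V)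
    (hE : ∀ k, c k ≠ c (k + 1) → (c k, c (k + 1)) ∈ E) (t : V → V) (ht : t (c 0) = c 0) (m : ℕ) :
    auxQ E n c (t, c 0) (m + 1) =
      (Function.update (Function.update (auxQ E n c (t, c 0) m).1 (c m) (c (m + 1)))
        (c (m + 1)) (c (m + 1)), c (m + 1)) := by
  obtain ⟨h1, h2⟩ := auxQ_root E n c hE t ht m
  rw [auxQ_succ, aux_step _ _ _ (by rw [h1]; exact hE _) (by rw [h1]; exact h2), h1]

theorem auxQ_off {V : Type*} [DecidableEq V] (E : Set (V × V)) (n : ℕ) (c : ZMod n → V)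
    (hE : ∀ k, c k ≠ c (k + 1) → (c k, c (k + 1)) ∈ E) (t : V → V) (ht : t (c 0) = c 0) (m : ℕ) (v : V) (hv : ∀ k, c k ≠ v) :
    (auxQ E n c (t, c 0) m).1 v = t v := by
  induction m with
  | zero => rfl
  | succ m ih =>
    rw [auxQ_succ' E n c hE t ht]
    simp only
    rw [Function.update_of_ne (hv _).symm, Function.update_of_ne (hv _).symm, ih]

theorem auxQ_det {V : Type*} [DecidableEq V] (E : Set (V × V)) (n : ℕ) (c : ZMod n → V)
    (hE : ∀ k, c k ≠ c (k + 1) → (c k, c (k + 1)) ∈ E) (t s : V → V) (ht : t (c 0) = c 0) (hs : s (c 0) = c 0) (m : ℕ) :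
    ∀ k ≤ m, (auxQ E n c (t, c 0) m).1 (c k) = (auxQ E n c (s, c 0) m).1 (c k) := by
  induction m with
  | zero =>
    intro k hk
    obtain rfl : k = 0 := by omega
    simp [auxQ_zero, ht, hs]
  | succ m ih =>
    intro k hk
    rw [auxQ_succ' E n c hE t ht, auxQ_succ' E n c hE s hs]
    simp only
    by_cases h1 : c k = c (m + 1)
    · rw [h1]; simp
    rw [Function.update_of_ne h1, Function.update_of_ne h1]
    by_cases h2 : c k = c m
    · rw [h2]; simp
    rw [Function.update_of_ne h2, Function.update_of_ne h2]
    apply ih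
    rcases Nat.lt_or_ge m k with h | h
    · exfalso
      obtain rfl : k = m + 1 := by omega
      apply h1
      push_cast
      rfl
    · exact h

theorem auxQ_reach {V : Type*} [DecidableEq V] (E : Set (V × V)) (n : ℕ) (c : ZMod n → V)
    (hE : ∀ k, c k ≠ c (k + 1) → (c k, c (k + 1)) ∈ E) (t : V → V) (ht : t (c 0) = c 0) (m : ℕ) :
    ∀ k ≤ m, (∃ l, (auxQ E n c (t, c 0) m).1^[l] (c k) = c m) ∧
      (c k ≠ c m → (c k, (auxQ E n c (t, c 0) m).1 (c k)) ∈ E) := by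
  induction m with
  | zero =>
    intro k hk
    obtain rfl : k = 0 := by omega
    exact ⟨⟨0, rfl⟩, fun h => absurd rfl h⟩
  | succ m ih =>
    intro k hk
    rw [auxQ_succ' E n c hE t ht]
    simp only
    push_cast
    by_cases h1 : c k = c (m + 1)
    · exact ⟨⟨0, h1⟩, fun h => absurd h1 h⟩
    have hkm : k ≤ m := by
      rcases Nat.lt_or_ge m k with h | h
      · exfalso
        obtain rfl : k = m + 1 := by omega
        apply h1
        push_cast
        rfl
      · exact h
    obtain ⟨⟨l, hl⟩, h3⟩ := ih k hkm
    refine ⟨aux_reach_step _ _ _ l _ hl, fun _ => ?_⟩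
    rw [Function.update_of_ne h1]
    by_cases h2 : c k = c m
    · rw [h2]
      simp only [Function.update_self]
      exact hE _ (by rw [← h2]; exact h1)
    · rw [Function.update_of_ne h2]
      exact h3 h2

theorem auxQ_tree {V : Type*} [DecidableEq V] (E : Set (V × V)) (n : ℕ) (c : ZMod n → V)
    (hE : ∀ k, c k ≠ c (k + 1) → (c k, c (k + 1)) ∈ E) (t : V → V) (ht : IsSpanningTree E (c 0) t) (m : ℕ) :
    IsSpanningTree E (auxQ E n c (t, c 0) m).2 (auxQ E n c (t, c 0) m).1 := by
  induction m with
  | zero => exact ht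
  | succ m ih =>
    by_cases h : c m = c (m + 1)
    · have : auxQ E n c (t, c 0) (m + 1) = auxQ E n c (t, c 0) m := by
        rw [auxQ_succ, stepF, if_pos]
        rw [(auxQ_root E n c hE t ht.1 m).1, h]
      rw [this]; exact ih
    · rw [auxQ_succ' E n c hE t ht.1]
      rw [(auxQ_root E n c hE t ht.1 m).1] at ih
      exact aux_tree_step E _ _ _ (hE _ h) ih

theorem aux_part1 {V : Type*} [Fintype V] [DecidableEq V] (E : Set (V × V)) (n : ℕ) [NeZero n]
    (c : ZMod n → V) (hE : ∀ k, c k ≠ c (k + 1) → (c k, c (k + 1)) ∈ E) :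
    Nat.card {t : V → V // IsSpanningTree E (c 0) t ∧ auxQ E n c (t, c 0) n = (t, c 0)}
      = kForest E (Finset.univ.image c) := by
  set W := Finset.univ.image c with hW
  have memW : ∀ k, c k ∈ W := fun k => by simp [hW]
  have offW : ∀ v, v ∉ W → ∀ k, c k ≠ v := fun v hv k h => hv (h ▸ memW k)
  have inW : ∀ v, v ∈ W → ∃ k : ℕ, k ≤ n ∧ c k = v := by
    intro v hv
    simp only [hW, Finset.mem_image, Finset.mem_univ, true_and] at hv
    obtain ⟨k, rfl⟩ := hv
    exact ⟨k.val, (ZMod.val_lt k).le, by simp⟩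
  have hroot : ∀ t : V → V, t (c 0) = c 0 → (auxQ E n c (t, c 0) n).2 = c 0 := by
    intro t ht
    simpa using (auxQ_root E n c hE t ht n).1
  have hroot' : ∀ t : V → V, t (c 0) = c 0 → (auxQ E n c (t, c 0) n).1 (c 0) = c 0 := by
    intro t ht
    simpa using (auxQ_root E n c hE t ht n).2
  unfold kForest
  refine Nat.card_congr ⟨fun t => ⟨fun v => if v ∈ W then v else t.1 v, ?_⟩,
    fun f => ⟨(auxQ E n c (f.1, c 0) n).1, ?_⟩, ?_, ?_⟩
  · obtain ⟨t, ht, hq⟩ := t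
    refine ⟨fun w hw => by simp [hw], fun v hv => ?_, fun v => ?_⟩
    · simp only [hv, if_false]
      exact ht.2.1 v (offW v hv 0).symm
    · obtain ⟨m, hm⟩ := ht.2.2 v
      exact aux_reach_agree W t _ (fun v hv => by simp [hv]) m v (hm ▸ memW 0)
  · obtain ⟨f, hf⟩ := f
    have hf0 := hf.1 _ (memW 0)
    have hg0 := hroot' f hf0
    refine ⟨⟨hg0, ?_, ?_⟩, ?_⟩
    · intro v hv
      by_cases hvW : v ∈ W
      · obtain ⟨k, hk, rfl⟩ := inW v hvW
        exact (auxQ_reach E n c hE f hf0 n k hk).2 (by simpa using hv)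
      · simp only
        rw [auxQ_off E n c hE f hf0 n v (offW v hvW)]
        exact hf.2.1 v hvW
    · intro v
      obtain ⟨m, hm⟩ := hf.2.2 v
      obtain ⟨l, hl⟩ := aux_reach_agree W f (auxQ E n c (f, c 0) n).1
        (fun v hv => auxQ_off E n c hE f hf0 n v (offW v hv)) m v hm
      obtain ⟨k, hk, hkv⟩ := inW _ hl
      obtain ⟨l', hl'⟩ := (auxQ_reach E n c hE f hf0 n k hk).1
      refine ⟨l' + l, ?_⟩
      rw [Function.iterate_add_apply]
      simp only
      rw [← hkv, hl']
      simp
    · simp only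
      refine Prod.ext (funext fun v => ?_) (hroot _ hg0)
      by_cases hvW : v ∈ W
      · obtain ⟨k, hk, rfl⟩ := inW v hvW
        exact auxQ_det E n c hE _ _ hg0 hf0 n k hk
      · exact auxQ_off E n c hE _ hg0 n v (offW v hvW)
  · rintro ⟨t, ht, hq⟩
    apply Subtype.ext
    funext v
    have h0 : (fun v => if v ∈ W then v else t v) (c 0) = c 0 := by simp [memW 0]
    simp only at h0 ⊢
    by_cases hvW : v ∈ W
    · obtain ⟨k, hk, rfl⟩ := inW v hvW
      rw [auxQ_det E n c hE _ t h0 ht.1 n k hk, hq]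
    · rw [auxQ_off E n c hE _ h0 n v (offW v hvW)]
      simp [hvW]
  · rintro ⟨f, hf⟩
    apply Subtype.ext
    funext v
    simp only
    by_cases hvW : v ∈ W
    · simp [hvW, hf.1 v hvW]
    · simp only [hvW, if_false]
      exact auxQ_off E n c hE f (hf.1 _ (memW 0)) n v (offW v hvW)

theorem aux_lift {V : Type*} [Fintype V] [DecidableEq V] (E : Set (V × V)) (P : Matrix V V ℝ)
    (i j : V) (hE : i ≠ j → (i, j) ∈ E) (hP : 0 < P i j) (t s : STree E)
    (ht : t.root = i) (hs : s.root = j) :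
    0 < liftP E P t s ↔ s.1 = stepF E t.1 j := by
  have hr : t.1.2 = i := ht
  have hr' : s.1.2 = j := hs
  unfold liftP stepF
  by_cases h : j = i
  · subst h
    rw [if_pos hr.symm]
    by_cases hts : t = s
    · subst hts
      simp [ht, hP]
    · rw [if_neg hts, if_neg (fun h => h.1 (ht.trans hs.symm))]
      simp only [lt_self_iff_false, false_iff]
      exact fun h => hts (Subtype.ext h.symm)
  · have hne : t ≠ s := fun h' => h (by rw [← hs, ← ht, h'])
    have hij := hE (Ne.symm h)
    rw [if_neg hne, hr, if_neg h, if_pos hij]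
    constructor
    · intro hpos
      by_cases he : STreeEdge E t s
      · have := he.2.2
        rw [ht, hs] at this
        exact Prod.ext this hr'
      · simp [he] at hpos
    · intro heq
      have he : STreeEdge E t s := by
        refine ⟨by rw [ht, hs]; exact Ne.symm h, by rw [ht, hs]; exact hij, ?_⟩
        rw [ht, hs]
        exact congrArg Prod.fst heq
      rw [if_pos he, ht, hs]
      exact hP

theorem aux_part2 {V : Type*} [Fintype V] [DecidableEq V] (E : Set (V × V)) (P : Matrix V V ℝ)
    (n : ℕ) [NeZero n]
    (c : ZMod n → V) (hE : ∀ k, c k ≠ c (k + 1) → (c k, c (k + 1)) ∈ E)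
    (hc : ∀ k : ZMod n, 0 < P (c k) (c (k + 1))) :
    Nat.card {T : ZMod n → STree E //
        (∀ k : ZMod n, 0 < liftP E P (T k) (T (k + 1))) ∧ ∀ k : ZMod n, (T k).root = c k} =
    Nat.card {t : V → V // IsSpanningTree E (c 0) t ∧ auxQ E n c (t, c 0) n = (t, c 0)} := by
  have key : ∀ T : ZMod n → STree E, (∀ k : ZMod n, 0 < liftP E P (T k) (T (k + 1))) →
      (∀ k : ZMod n, (T k).root = c k) →
      ∀ m : ℕ, (T m).1 = auxQ E n c ((T 0).1.1, c 0) m := by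
    intro T h1 h2 m
    induction m with
    | zero =>
      rw [auxQ_zero, Nat.cast_zero]
      exact Prod.ext rfl (h2 0)
    | succ m ih =>
      rw [auxQ_succ, ← ih, Nat.cast_succ]
      exact (aux_lift E P _ _ (hE m) (hc m) _ _ (h2 _) (h2 _)).1 (h1 m)
  refine Nat.card_congr (Equiv.ofBijective
    (fun T => ⟨(T.1 0).1.1, ?_, ?_⟩) ⟨?_, ?_⟩)
  · obtain ⟨T, h1, h2⟩ := T
    have := (T 0).2
    rw [show (T 0).1.2 = c 0 from h2 0] at this
    exact this
  · obtain ⟨T, h1, h2⟩ := T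
    simp only
    rw [← key T h1 h2 n, ZMod.natCast_self]
    exact Prod.ext rfl (h2 0)
  · rintro ⟨T, h1, h2⟩ ⟨S, h3, h4⟩ h
    have h : (T 0).1.1 = (S 0).1.1 := congrArg Subtype.val h
    apply Subtype.ext
    funext k
    apply Subtype.ext
    have a := key T h1 h2 k.val
    have b := key S h3 h4 k.val
    rw [h, ← b] at a
    simpa using a
  · rintro ⟨t, ht, hq⟩
    have hr : ∀ k : ZMod n, (auxQ E n c (t, c 0) k.val).2 = c k := fun k => by
      simpa using (auxQ_root E n c hE t ht.1 k.val).1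
    refine ⟨⟨fun k => ⟨auxQ E n c (t, c 0) k.val, auxQ_tree E n c hE t ht k.val⟩,
      fun k => ?_, hr⟩, ?_⟩
    · refine (aux_lift E P _ _ (hE k) (hc k)
        ⟨_, auxQ_tree E n c hE t ht k.val⟩ ⟨_, auxQ_tree E n c hE t ht (k + 1).val⟩
        (hr k) (hr (k + 1))).2 ?_
      simp only
      have hs := auxQ_succ E n c (t, c 0) k.val
      rw [ZMod.natCast_val, ZMod.cast_id] at hs
      rw [← hs]
      have hlt := ZMod.val_lt k
      rcases Nat.lt_or_ge (k.val + 1) n with h | h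
      · congr 1
        have : (k + 1) = ((k.val + 1 : ℕ) : ZMod n) := by simp
        rw [this, ZMod.val_natCast, Nat.mod_eq_of_lt h]
      · have h' : k.val + 1 = n := by omega
        have : k + 1 = 0 := by
          have : (k + 1) = ((k.val + 1 : ℕ) : ZMod n) := by simp
          rw [this, h', ZMod.natCast_self]
        rw [this, h', hq, ZMod.val_zero, auxQ_zero]
    · apply Subtype.ext
      simp [auxQ_zero]

/-- for a cycle `c` of `P` with vertex set `W`, the number of spanning trees
rooted at `c 0` fixed by traversing `c` equals `k(W)`; consequently the number of cycles of
the lifted chain projecting to `c` equals `k(W)`. -/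
theorem stmt3 {V : Type*} [Fintype V] [DecidableEq V] [Nonempty V]
    (E : Set (V × V)) (hloop : ∀ v : V, (v, v) ∉ E) (hconn : StronglyConnected E)
    (P : Matrix V V ℝ) (hP : IsTransMatrix E P)
    (n : ℕ) [NeZero n] (c : ZMod n → V)
    (hc : ∀ k : ZMod n, 0 < P (c k) (c (k + 1))) :
    Nat.card {t : V → V // IsSpanningTree E (c 0) t ∧ traverse E n c (t, c 0) = (t, c 0)}
      = kForest E (Finset.univ.image c) ∧
    Nat.card {T : ZMod n → STree E //
        (∀ k : ZMod n, 0 < liftP E P (T k) (T (k + 1))) ∧ ∀ k : ZMod n, (T k).root = c k}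
      = kForest E (Finset.univ.image c) := by
  have hE : ∀ k, c k ≠ c (k + 1) → (c k, c (k + 1)) ∈ E := fun k h => (hP.2.2 _ _ h).1 (hc k)
  exact ⟨aux_part1 E n c hE, (aux_part2 E P n c hE hc).trans (aux_part1 E n c hE)⟩
end
end

section
/- Let P be a transition matrix associated with G, let n ≥ 1, and let c : ZMod n → V be a cycle in P (P (c k) (c (k+1)) > 0 for every k) with vertex set W = range(c). Let f be a spanning forest of G rooted in W. If t₁ and t₂ are spanning trees of G rooted at c 0 which both contain f (i.e. t₁ v = f v and t₂ v = f v for all v ∉ W), then traverse(c, t₁) = traverse(c, t₂); moreover this common tree is rooted at c 0 and contains f. -/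
open Matrix Finset Classical

noncomputable section

theorem aux_stepF_tree {V : Type*} [DecidableEq V] (E : Set (V × V)) (t : V → V) (i j : V)
    (ht : IsSpanningTree E i t) (hij : (i, j) ∈ E) (hne : j ≠ i) :
    IsSpanningTree E j (Function.update (Function.update t i j) j j) := by
  obtain ⟨h1, h2, h3⟩ := ht
  refine ⟨by simp, ?_, ?_⟩
  · intro v hv
    rw [Function.update_of_ne hv]
    by_cases hvi : v = i
    · subst hvi; simpa using hij
    · rw [Function.update_of_ne hvi]; exact h2 v hvi
  · intro v
    obtain ⟨n, hn⟩ := h3 v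
    induction n generalizing v with
    | zero =>
      refine ⟨1, ?_⟩
      have : v = i := by simpa using hn
      subst this
      simp [Function.update_of_ne (Ne.symm hne)]
    | succ n ih =>
      by_cases hvj : v = j
      · exact ⟨0, by simpa using hvj⟩
      by_cases hvi : v = i
      · refine ⟨1, ?_⟩
        subst hvi
        simp [Function.update_of_ne (Ne.symm hne)]
      · rw [Function.iterate_succ_apply] at hn
        obtain ⟨m, hm⟩ := ih _ hn
        refine ⟨m + 1, ?_⟩
        rw [Function.iterate_succ_apply, Function.update_of_ne hvj, Function.update_of_ne hvi]
        exact hm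

theorem aux_invariant {V : Type*} [Fintype V] [DecidableEq V]
    (E : Set (V × V)) (n : ℕ) [NeZero n] (c : ZMod n → V)
    (hc : ∀ k : ZMod n, c (k + 1) ≠ c k → (c k, c (k + 1)) ∈ E)
    (f : V → V) (t₁ t₂ : V → V)
    (ht₁ : IsSpanningTree E (c 0) t₁) (ht₂ : IsSpanningTree E (c 0) t₂)
    (hft₁ : ∀ v, v ∉ Finset.univ.image c → t₁ v = f v)
    (hft₂ : ∀ v, v ∉ Finset.univ.image c → t₂ v = f v) (m : ℕ) :
    ∃ s₁ s₂ : V → V,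
      ((List.range m).map (Nat.cast : ℕ → ZMod n)).foldl (fun q i => stepF E q (c (i + 1)))
        (t₁, c 0) = (s₁, c m) ∧
      ((List.range m).map (Nat.cast : ℕ → ZMod n)).foldl (fun q i => stepF E q (c (i + 1)))
        (t₂, c 0) = (s₂, c m) ∧
      IsSpanningTree E (c m) s₁ ∧
      (∀ v, v ∉ Finset.univ.image c → s₁ v = f v) ∧
      (∀ v, v ∉ Finset.univ.image c → s₂ v = f v) ∧
      ∀ k ≤ m, s₁ (c (k : ZMod n)) = s₂ (c (k : ZMod n)) := by
  induction m with
  | zero =>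
    refine ⟨t₁, t₂, by simp, by simp, by simpa using ht₁, hft₁, hft₂, ?_⟩
    intro k hk
    obtain rfl : k = 0 := by omega
    simp only [Nat.cast_zero]
    rw [ht₁.1, ht₂.1]
  | succ m ih =>
    obtain ⟨s₁, s₂, e₁, e₂, hT, h₁, h₂, hk⟩ := ih
    simp only [List.range_succ, List.map_append, List.map_cons, List.map_nil, List.foldl_append,
      e₁, e₂, List.foldl_cons, List.foldl_nil,
      Nat.cast_succ]
    by_cases hj : c ((m : ZMod n) + 1) = c m
    · refine ⟨s₁, s₂, by simp [stepF, hj], by simp [stepF, hj], by rwa [hj], h₁, h₂, ?_⟩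
      intro k hkm
      rcases Nat.lt_or_ge m k with h | h
      · obtain rfl : k = m + 1 := by omega
        rw [Nat.cast_succ, hj]; exact hk m le_rfl
      · exact hk k h
    · have hE := hc _ hj
      refine ⟨_, _, by simp only [stepF, if_neg hj, if_pos hE],
        by simp only [stepF, if_neg hj, if_pos hE]; rfl, aux_stepF_tree E s₁ _ _ hT hE hj,
        ?_, ?_, ?_⟩
      · intro v hv
        have a : ∀ k, v ≠ c k := fun k h => hv (by simp [h])
        rw [Function.update_of_ne (a _), Function.update_of_ne (a _), h₁ v hv]
      · intro v hv
        have a : ∀ k, v ≠ c k := fun k h => hv (by simp [h])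
        rw [Function.update_of_ne (a _), Function.update_of_ne (a _), h₂ v hv]
      · intro k hkm
        rcases Nat.lt_or_ge m k with h | h
        · obtain rfl : k = m + 1 := by omega
          simp
        · simp only [Function.update_apply, hk k h]

/-- if two spanning trees rooted at `c 0` contain the same spanning forest `f`
rooted in the vertex set `W` of the cycle `c`, then traversing `c` from either yields the same
spanning tree, which is rooted at `c 0` and contains `f`. -/
theorem stmt4 {V : Type*} [Fintype V] [DecidableEq V] [Nonempty V]
    (E : Set (V × V)) (hloop : ∀ v : V, (v, v) ∉ E) (hconn : StronglyConnected E)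
    (P : Matrix V V ℝ) (hP : IsTransMatrix E P)
    (n : ℕ) [NeZero n] (c : ZMod n → V)
    (hc : ∀ k : ZMod n, 0 < P (c k) (c (k + 1)))
    (f : V → V) (hf : IsSpanningForest E (Finset.univ.image c) f)
    (t₁ t₂ : V → V)
    (ht₁ : IsSpanningTree E (c 0) t₁) (ht₂ : IsSpanningTree E (c 0) t₂)
    (hft₁ : ∀ v, v ∉ Finset.univ.image c → t₁ v = f v)
    (hft₂ : ∀ v, v ∉ Finset.univ.image c → t₂ v = f v) :
    traverse E n c (t₁, c 0) = traverse E n c (t₂, c 0) ∧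
    (traverse E n c (t₁, c 0)).2 = c 0 ∧
    IsSpanningTree E (c 0) (traverse E n c (t₁, c 0)).1 ∧
    ∀ v, v ∉ Finset.univ.image c → (traverse E n c (t₁, c 0)).1 v = f v := by
  have hE : ∀ k : ZMod n, c (k + 1) ≠ c k → (c k, c (k + 1)) ∈ E :=
    fun k h => (hP.2.2 _ _ (Ne.symm h)).1 (hc k)
  obtain ⟨s₁, s₂, e₁, e₂, hT, h₁, h₂, hk⟩ :=
    aux_invariant E n c hE f t₁ t₂ ht₁ ht₂ hft₁ hft₂ n
  rw [ZMod.natCast_self] at e₁ e₂ hT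
  have hs : s₁ = s₂ := by
    funext v
    by_cases hv : v ∈ Finset.univ.image c
    · obtain ⟨k, -, rfl⟩ := Finset.mem_image.1 hv
      have := hk k.val (ZMod.val_lt k).le
      rwa [ZMod.natCast_zmod_val] at this
    · rw [h₁ v hv, h₂ v hv]
  have htr : ∀ p : (V → V) × V, _root_.traverse E n c p =
      ((List.range n).map (Nat.cast : ℕ → ZMod n)).foldl (fun q i => stepF E q (c (i + 1))) p := by
    intro p
    unfold _root_.traverse
    congr 1
    rw [List.map_eq_flatMap]
    rfl
  rw [htr, htr, e₁, e₂]
  exact ⟨by rw [hs], rfl, hT, h₁⟩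
end
end

section
/- Let P be a transition matrix associated with G and let s : V → ℝ satisfy |s v| < 1 for all v. Then the vertex-weighted stochastic zeta function satisfies Real.exp (∑'_{n ≥ 1} (1/n) · ∑_{c : ZMod n → V} ∏_k (s (c k) · P (c k) (c (k+1)))) = (det (1 − (Matrix.diagonal s) * P))⁻¹, where for each n ≥ 1 the inner (finite) sum ranges over all functions c : ZMod n → V, i.e. over all cycles of length n with their s-weights wt(c; s) = ∏_k s(c k) · P (c k) (c (k+1)). -/
open Matrix Finset Classical

noncomputable section

lemma aux_path {V : Type*} [Fintype V] [DecidableEq V] (A : Matrix V V ℝ) (n : ℕ) :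
    ∀ F : V → V → ℝ, ∑ c : Fin (n + 1) → V, F (c 0) (c (Fin.last n)) *
      ∏ k : Fin n, A (c k.castSucc) (c k.succ) = ∑ i, ∑ j, F i j * (A ^ n) i j := by
  induction n with
  | zero =>
    intro F
    rw [← (Equiv.funUnique (Fin 1) V).symm.sum_comp]
    simp [Matrix.one_apply]
  | succ n ih =>
    intro F
    rw [← (Fin.consEquiv (fun _ : Fin (n + 2) => V)).sum_comp, Fintype.sum_prod_type]
    refine Finset.sum_congr rfl fun a _ => ?_
    have h := ih (fun i j => F a j * A a i)
    have h2 : ∀ c : Fin (n + 1) → V,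
        F ((Fin.consEquiv (fun _ : Fin (n + 2) => V)) (a, c) 0)
          ((Fin.consEquiv (fun _ : Fin (n + 2) => V)) (a, c) (Fin.last (n + 1))) *
        ∏ k : Fin (n + 1), A ((Fin.consEquiv (fun _ : Fin (n + 2) => V)) (a, c) k.castSucc)
          ((Fin.consEquiv (fun _ : Fin (n + 2) => V)) (a, c) k.succ)
        = F a (c (Fin.last n)) * A a (c 0) * ∏ k : Fin n, A (c k.castSucc) (c k.succ) := by
      intro c
      rw [Fin.prod_univ_succ]
      simp [Fin.consEquiv, ← Fin.succ_last, ← Fin.succ_castSucc, mul_assoc]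
    rw [Finset.sum_congr rfl fun c _ => h2 c, h, Finset.sum_comm]
    refine Finset.sum_congr rfl fun j _ => ?_
    rw [pow_succ', Matrix.mul_apply, Finset.mul_sum]
    simp [mul_assoc]

lemma aux_cycle {V : Type*} [Fintype V] [DecidableEq V] (A : Matrix V V ℝ) (n : ℕ) :
    ∑ c : ZMod (n + 1) → V, ∏ k : ZMod (n + 1), A (c k) (c (k + 1)) = (A ^ (n + 1)).trace := by
  change ∑ c : Fin (n + 1) → V, ∏ k : Fin (n + 1), A (c k) (c (k + 1)) = (A ^ (n + 1)).trace
  have h := aux_path A n (fun i j => A j i)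
  rw [pow_succ', Matrix.trace]
  simp only [Matrix.diag_apply, Matrix.mul_apply]
  rw [Finset.sum_comm, ← h]
  refine Finset.sum_congr rfl fun c _ => ?_
  rw [Fin.prod_univ_castSucc, mul_comm]
  simp

lemma aux_det {V : Type*} [Fintype V] [DecidableEq V] (A : Matrix V V ℂ)
    (m : Multiset ℂ) (hm : ∀ x, (Matrix.scalar V x - A).det = (m.map (fun l => x - l)).prod)
    (hc : Multiset.card m = Fintype.card V)
    (q : Polynomial ℂ) :
    (Polynomial.aeval A q).det = (m.map (fun l => q.eval l)).prod := by
  have hs := IsAlgClosed.splits q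
  have key : ∀ t : Multiset ℂ,
      (Polynomial.aeval A ((t.map (fun a => Polynomial.X - Polynomial.C a)).prod)).det
       = (m.map (fun l =>
          ((t.map (fun a => Polynomial.X - Polynomial.C a)).prod).eval l)).prod := by
    intro t
    induction t using Multiset.induction_on with
    | empty => simp
    | cons a t ih =>
      have h1 : (A - Matrix.scalar V a).det = (m.map (fun l => l - a)).prod := by
        rw [← neg_sub, Matrix.det_neg, hm, ← hc, ← Multiset.card_map (fun l => a - l) m,
          ← Multiset.prod_map_neg]
        simp [Multiset.map_map]
      have h2 : (algebraMap ℂ (Matrix V V ℂ)) a = Matrix.scalar V a := rfl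
      simp only [Multiset.map_cons, Multiset.prod_cons, map_mul, Matrix.det_mul, ih,
        Polynomial.eval_mul, Multiset.prod_map_mul, map_sub, Polynomial.aeval_X,
        Polynomial.aeval_C, h2, h1, Polynomial.eval_sub, Polynomial.eval_X, Polynomial.eval_C]
  rw [hs.eq_prod_roots, map_mul, Matrix.det_mul, key]
  simp only [Polynomial.eval_mul, Multiset.prod_map_mul, Polynomial.eval_C, Polynomial.aeval_C]
  congr 1
  have h2 : (algebraMap ℂ (Matrix V V ℂ)) q.leadingCoeff = Matrix.scalar V q.leadingCoeff := rfl
  simp [h2, hc]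

lemma aux_roots {V : Type*} [Fintype V] [DecidableEq V] (A : Matrix V V ℂ) (x : ℂ) :
    (Matrix.scalar V x - A).det = (A.charpoly.roots.map (fun l => x - l)).prod := by
  rw [← Matrix.eval_charpoly]
  conv_lhs => rw [(IsAlgClosed.splits A.charpoly).eq_prod_roots_of_monic A.charpoly_monic]
  rw [Polynomial.eval_multiset_prod, Multiset.map_map]
  simp

lemma aux_card {V : Type*} [Fintype V] [DecidableEq V] (A : Matrix V V ℂ) :
    Multiset.card A.charpoly.roots = Fintype.card V := by
  rw [← (IsAlgClosed.splits A.charpoly).natDegree_eq_card_roots, A.charpoly_natDegree_eq_dim]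

lemma aux_trace {V : Type*} [Fintype V] [DecidableEq V] (A : Matrix V V ℂ) (n : ℕ) :
    (A ^ n).trace = (A.charpoly.roots.map (fun l => l ^ n)).sum := by
  have h : (A ^ n).charpoly
      = ((A.charpoly.roots.map (fun l => l ^ n)).map
          (fun a => Polynomial.X - Polynomial.C a)).prod := by
    apply Polynomial.funext
    intro x
    have h1 := aux_det A _ (aux_roots A) (aux_card A) (Polynomial.C x - Polynomial.X ^ n)
    have h2 : (algebraMap ℂ (Matrix V V ℂ)) x = Matrix.scalar V x := rfl
    rw [Matrix.eval_charpoly, Polynomial.eval_multiset_prod, Multiset.map_map, Multiset.map_map]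
    simp only [map_sub, Polynomial.aeval_C, map_pow, Polynomial.aeval_X, h2] at h1
    rw [h1]
    simp
  rw [Matrix.trace_eq_sum_roots_charpoly, h, Polynomial.roots_multiset_prod_X_sub_C]

lemma aux_log (m : Multiset ℂ) (hm : ∀ l ∈ m, ‖l‖ < 1) :
    ∃ L : ℂ, HasSum (fun n : ℕ => (1 / (n + 1) : ℂ) * (m.map (fun l => l ^ (n + 1))).sum) L ∧
      Complex.exp L = ((m.map (fun l => 1 - l)).prod)⁻¹ := by
  induction m using Multiset.induction_on with
  | empty => exact ⟨0, by simp [hasSum_zero]⟩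
  | cons a m ih =>
    obtain ⟨L, h1, h2⟩ := ih fun l hl => hm l (Multiset.mem_cons_of_mem hl)
    have ha := hm a (Multiset.mem_cons_self a m)
    have h3 := Complex.hasSum_taylorSeries_neg_log ha
    rw [← hasSum_nat_add_iff' 1] at h3
    refine ⟨-Complex.log (1 - a) + L, ?_, ?_⟩
    · simp only [Multiset.map_cons, Multiset.sum_cons, mul_add]
      refine HasSum.add ?_ h1
      have h4 : HasSum (fun n : ℕ => a ^ (n + 1) / ((n + 1 : ℕ) : ℂ)) (-Complex.log (1 - a)) := by
        simpa using h3
      have h5 : (fun n : ℕ => (1 / (n + 1) : ℂ) * a ^ (n + 1))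
          = fun n : ℕ => a ^ (n + 1) / ((n + 1 : ℕ) : ℂ) := by
        funext n
        push_cast
        ring
      rw [h5]
      exact h4
    · have : (1 - a) ≠ 0 := by
        intro h
        have : a = 1 := (sub_eq_zero.mp h).symm
        simp [this] at ha
      rw [Complex.exp_add, Complex.exp_neg, Complex.exp_log this, h2]
      simp [mul_comm]

/-- the vertex-weighted stochastic zeta function satisfies
`ζ_G(s) = 1 / det(I - SP)` where `S = diag(s)`. -/
theorem stmt6 {V : Type*} [Fintype V] [DecidableEq V] [Nonempty V]
    (E : Set (V × V)) (hloop : ∀ v : V, (v, v) ∉ E) (hconn : StronglyConnected E)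
    (P : Matrix V V ℝ) (hP : IsTransMatrix E P)
    (s : V → ℝ) (hs : ∀ v, |s v| < 1) :
    Real.exp (∑' n : ℕ, (1 / (n + 1) : ℝ) *
        ∑ c : ZMod (n + 1) → V, ∏ k : ZMod (n + 1), s (c k) * P (c k) (c (k + 1)))
      = (Matrix.det (1 - Matrix.diagonal s * P))⁻¹ := by
  set A : Matrix V V ℝ := Matrix.diagonal s * P with hA
  have hAe : ∀ i j, A i j = s i * P i j := fun i j => by simp [hA, Matrix.diagonal_mul]
  set B : Matrix V V ℂ := A.map Complex.ofRealHom with hB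
  have hnorm : ∀ l ∈ B.charpoly.roots, ‖l‖ < 1 := by
    intro l hl
    by_contra! hge
    have hroot := (Polynomial.mem_roots'.mp hl).2
    rw [Polynomial.IsRoot, Matrix.eval_charpoly] at hroot
    refine det_ne_zero_of_sum_row_lt_diag (A := Matrix.scalar V l - B) ?_ hroot
    intro k
    have e1 : ∀ j ∈ Finset.univ.erase k, ‖(Matrix.scalar V l - B) k j‖ = |s k| * P k j := by
      intro j hj
      have hkj : k ≠ j := (Finset.ne_of_mem_erase hj).symm
      simp [hB, hAe, Matrix.diagonal_apply_ne _ hkj, abs_of_nonneg (hP.1 k j)]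
    rw [Finset.sum_congr rfl e1, ← Finset.mul_sum]
    have e2 := Finset.add_sum_erase Finset.univ (fun j => P k j) (Finset.mem_univ k)
    rw [hP.2.1 k] at e2
    have e3 : ‖l‖ - |s k| * P k k ≤ ‖(Matrix.scalar V l - B) k k‖ := by
      have := norm_sub_norm_le l (B k k)
      simpa [hB, hAe, abs_of_nonneg (hP.1 k k)] using this
    have e4 : |s k| * (P k k + ∑ j ∈ Finset.univ.erase k, P k j) < 1 := by
      rw [e2, mul_one]
      exact hs k
    nlinarith
  obtain ⟨L, hL, hexp⟩ := aux_log _ hnorm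
  have hterm : ∀ n : ℕ, (((1 / (n + 1) : ℝ) * ∑ c : ZMod (n + 1) → V,
      ∏ k : ZMod (n + 1), s (c k) * P (c k) (c (k + 1)) : ℝ) : ℂ)
      = (1 / (n + 1) : ℂ) * (B.charpoly.roots.map (fun l => l ^ (n + 1))).sum := by
    intro n
    have h1 := aux_cycle A n
    simp only [hAe] at h1
    rw [h1, ← aux_trace, hB]
    have : (A.map Complex.ofRealHom) ^ (n + 1) = (A ^ (n + 1)).map Complex.ofRealHom := by
      rw [← RingHom.mapMatrix_apply, ← map_pow, RingHom.mapMatrix_apply]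
    rw [this]
    simp [Matrix.trace]
  have hdet : (((1 - A).det : ℝ) : ℂ) = (B.charpoly.roots.map (fun l => 1 - l)).prod := by
    rw [← aux_roots, map_one, hB]
    change Complex.ofRealHom _ = _
    rw [RingHom.map_det, map_sub, map_one, RingHom.mapMatrix_apply]
  apply Complex.ofReal_injective
  rw [Complex.ofReal_exp, Complex.ofReal_tsum, Complex.ofReal_inv, hdet, ← hexp, ← hL.tsum_eq]
  congr 1
  exact tsum_congr hterm
end
end

section
/- Let n be a nonempty finite type and let A : Matrix n n ℝ satisfy ‖A‖ < 1 (with respect to the L∞ operator norm on matrices, under which the matrices form a normed ring). Then Real.exp (∑'_{k : ℕ} Matrix.trace (A^(k+1)) / (k+1)) = (Matrix.det (1 − A))⁻¹. -/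
noncomputable section

attribute [local instance] Matrix.linftyOpNormedRing

open Polynomial in
lemma aux_det_aeval {n : Type*} [Fintype n] [DecidableEq n] (B : Matrix n n ℂ) (p : ℂ[X]) :
    (aeval B p).det = (B.charpoly.roots.map (fun z => p.eval z)).prod := by
  have hs := IsAlgClosed.splits B.charpoly
  have hlin : ∀ t : ℂ, (aeval B (X - C t)).det
      = (B.charpoly.roots.map (fun z => (X - C t).eval z)).prod := by
    intro t
    have h1 : (Matrix.scalar n t - B).det = (B.charpoly.roots.map (fun z => t - z)).prod := by
      rw [← Matrix.eval_charpoly]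
      conv_lhs => rw [hs.eq_prod_roots_of_monic B.charpoly_monic]
      rw [eval_multiset_prod, Multiset.map_map]
      simp
    have h2 : aeval B (X - C t) = -(Matrix.scalar n t - B) := by
      simp [Matrix.algebraMap_eq_diagonal, Pi.algebraMap_def]
    have hc : B.charpoly.roots.card = Fintype.card n := by
      rw [← hs.natDegree_eq_card_roots, B.charpoly_natDegree_eq_dim]
    rw [h2, Matrix.det_neg, h1, ← hc]
    have : (fun z => (X - C t : ℂ[X]).eval z) = fun z => (-1) * (t - z) := by
      ext z; simp
    rw [this, Multiset.prod_map_mul]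
    simp
  have hc : B.charpoly.roots.card = Fintype.card n := by
    rw [← hs.natDegree_eq_card_roots, B.charpoly_natDegree_eq_dim]
  have hp : ∀ s : Multiset ℂ, (aeval B (s.map (fun a => X - C a)).prod).det
      = (B.charpoly.roots.map (fun z => (s.map (fun a => X - C a)).prod.eval z)).prod := by
    intro s
    induction s using Multiset.induction_on with
    | empty => simp
    | cons a s ih =>
      simp only [Multiset.map_cons, Multiset.prod_cons, map_mul, Matrix.det_mul, ih, hlin a,
        eval_mul, Multiset.prod_map_mul]
  rw [(IsAlgClosed.splits p).eq_prod_roots]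
  simp only [map_mul, Matrix.det_mul, eval_mul, Multiset.prod_map_mul, hp]
  congr 1
  simp [Matrix.algebraMap_eq_diagonal, Pi.algebraMap_def, hc]

open Polynomial in
lemma aux_det_one_sub {n : Type*} [Fintype n] [DecidableEq n] (B : Matrix n n ℂ) :
    (1 - B).det = (B.charpoly.roots.map (fun z => 1 - z)).prod := by
  have h := aux_det_aeval B (1 - X : ℂ[X])
  simp only [map_sub, map_one, aeval_X, eval_sub, eval_one, eval_X] at h
  exact h

open Polynomial in
lemma aux_trace_pow {n : Type*} [Fintype n] [DecidableEq n] (B : Matrix n n ℂ) (k : ℕ) :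
    (B ^ k).trace = (B.charpoly.roots.map (fun z => z ^ k)).sum := by
  have h : (B ^ k).charpoly
      = ((B.charpoly.roots.map (fun z => z ^ k)).map (fun a => X - C a)).prod := by
    apply Polynomial.funext
    intro t
    have := aux_det_aeval B (C t - X ^ k)
    rw [Matrix.eval_charpoly, eval_multiset_prod, Multiset.map_map, Multiset.map_map]
    simpa [Matrix.algebraMap_eq_diagonal, Pi.algebraMap_def] using this
  rw [Matrix.trace_eq_sum_roots_charpoly, h, roots_multiset_prod_X_sub_C]

lemma aux_hasSum (s : Multiset ℂ) (hs : ∀ z ∈ s, ‖z‖ < 1) :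
    ∃ L, HasSum (fun k : ℕ => (s.map (fun z => z ^ (k + 1))).sum / ((k : ℂ) + 1)) L ∧
      Complex.exp L = ((s.map (fun z => 1 - z)).prod)⁻¹ := by
  induction s using Multiset.induction_on with
  | empty => exact ⟨0, by simp, by simp⟩
  | cons a s ih =>
    obtain ⟨L, h1, h2⟩ := ih (fun z hz => hs z (Multiset.mem_cons_of_mem hz))
    have ha := hs a (Multiset.mem_cons_self a s)
    have ha1 : 1 - a ≠ 0 := by
      intro h
      rw [← sub_eq_zero.mp h] at ha
      simp at ha
    refine ⟨-Complex.log (1 - a) + L, ?_, ?_⟩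
    · have := (Complex.hasSum_taylorSeries_neg_log' ha).add h1
      simpa [add_div] using this
    · rw [Complex.exp_add, h2, Complex.exp_neg, Complex.exp_log ha1]
      simp [mul_comm]

attribute [local instance] Matrix.linftyOpNormedAlgebra Matrix.linfty_opNormOneClass

lemma aux_norm {n : Type*} [Fintype n] [DecidableEq n]
    (A : Matrix n n ℝ) : ‖A.map (algebraMap ℝ ℂ)‖ = ‖A‖ := by
  simp [Matrix.linfty_opNorm_def]

/-- for a matrix `A` with `‖A‖ < 1` in the L∞ operator norm,
`exp(∑_{m ≥ 1} trace(A^m)/m) = 1/det(I - A)`. -/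
theorem stmt7 {n : Type*} [Fintype n] [DecidableEq n] [Nonempty n]
    (A : Matrix n n ℝ) (hA : ‖A‖ < 1) :
    Real.exp (∑' k : ℕ, Matrix.trace (A ^ (k + 1)) / (k + 1))
      = (Matrix.det (1 - A))⁻¹ := by
  set B : Matrix n n ℂ := (algebraMap ℝ ℂ).mapMatrix A with hB
  have hBn : ‖B‖ < 1 := by
    rw [← aux_norm] at hA
    exact hA
  obtain ⟨L, h1, h2⟩ := aux_hasSum B.charpoly.roots (fun z hz => by
    have hz' := Matrix.mem_spectrum_of_isRoot_charpoly (Polynomial.isRoot_of_mem_roots hz)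
    exact (spectrum.norm_le_norm_of_mem hz').trans_lt hBn)
  have hdet : (1 - B).det = (B.charpoly.roots.map (fun z => 1 - z)).prod := by
    exact aux_det_one_sub B
  have htr : ∀ k : ℕ, ((A ^ k).trace : ℂ) = (B ^ k).trace := by
    intro k
    rw [hB, ← map_pow]
    simp [Matrix.trace]
  have hdet' : (((1 - A).det : ℝ) : ℂ) = (1 - B).det := by
    have := RingHom.map_det (algebraMap ℝ ℂ) (1 - A)
    rw [map_sub, map_one] at this
    exact this
  apply Complex.ofReal_injective
  rw [Complex.ofReal_exp, Complex.ofReal_tsum, Complex.ofReal_inv, hdet', hdet, ← h2, ← h1.tsum_eq]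
  congr 2
  ext k
  rw [← aux_trace_pow, ← htr]
  push_cast
  rfl

end
end
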